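/- For every integer n ≥ 1 and every ξ ∈ F_q((T^{-1})) not algebraic of degree at most n, w_n^@(ξ) ≥ (w_n(ξ) + 1)/2. -/

import Mathlib

open Polynomial
open scoped Classical

namespace MahlerKoksmaFq

noncomputable section

variable (Fq : Type) [Field Fq] [Fintype Fq]

/-- `K Fq` models `F_q((T⁻¹))`: Laurent series in the variable `t = T⁻¹`. -/
abbrev K := LaurentSeries Fq

/-- The element `T` (the inverse of the Laurent-series variable `t = T⁻¹`). -/
def Tvar : K Fq := HahnSeries.single (-1 : ℤ) 1

/-- The absolute value `|ξ| = q^{-ν(ξ)}` on `F_q((T⁻¹))`. -/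
def absK (ξ : K Fq) : ℝ :=
  if ξ = 0 then 0 else (Fintype.card Fq : ℝ) ^ (-(HahnSeries.order ξ))

/-- The embedding of `F_q[T]` into `F_q((T⁻¹))`, sending `T` to `Tvar`. -/
def emb : Polynomial Fq →+* K Fq :=
  Polynomial.eval₂RingHom (algebraMap Fq (K Fq)) (Tvar Fq)

/-- Evaluation of `P ∈ F_q[T][X]` at `ξ ∈ F_q((T⁻¹))`. -/
def evalK (P : Polynomial (Polynomial Fq)) (ξ : K Fq) : K Fq :=
  P.eval₂ (emb Fq) ξ

/-- Height of a polynomial over `F_q[T]`: the maximum of the absolute values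
`q^{deg c}` of its coefficients. -/
def HP (P : Polynomial (Polynomial Fq)) : ℝ :=
  (Fintype.card Fq : ℝ) ^ (P.support.sup fun i => (P.coeff i).natDegree)

/-- `ξ` is algebraic (over `F_q[T]`) of degree at most `n`. -/
def IsAlgDegLe (ξ : K Fq) (n : ℕ) : Prop :=
  ∃ P : Polynomial (Polynomial Fq), P ≠ 0 ∧ P.natDegree ≤ n ∧ evalK Fq P ξ = 0

/-- `ξ` is algebraic over `F_q[T]`. -/
def IsAlgK (ξ : K Fq) : Prop :=
  ∃ P : Polynomial (Polynomial Fq), P ≠ 0 ∧ evalK Fq P ξ = 0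

/-- The degree of an algebraic element of `F_q((T⁻¹))`. -/
def degA (α : K Fq) : ℕ :=
  sInf {d | ∃ P : Polynomial (Polynomial Fq), P ≠ 0 ∧ P.natDegree = d ∧ evalK Fq P α = 0}

/-- The height of an algebraic element `α` of `F_q((T⁻¹))`: the least height of a
 nonzero annihilating polynomial of minimal degree (= height of the minimal
 defining polynomial over `F_q[T]`). -/
def HA (α : K Fq) : ℝ :=
  sInf {h | ∃ P : Polynomial (Polynomial Fq),
    P ≠ 0 ∧ P.natDegree = degA Fq α ∧ evalK Fq P α = 0 ∧ h = HP Fq P}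

/-- The defining set for Mahler's exponent `w_n`. -/
def wnSet (ξ : K Fq) (n : ℕ) : Set ℝ :=
  {w | {P : Polynomial (Polynomial Fq) |
      P.natDegree ≤ n ∧ 0 < absK Fq (evalK Fq P ξ) ∧
      absK Fq (evalK Fq P ξ) < HP Fq P ^ (-w)}.Infinite}

/-- Mahler's exponent `w_n(ξ)`. -/
def wn (ξ : K Fq) (n : ℕ) : EReal :=
  sSup ((fun w : ℝ => (w : EReal)) '' wnSet Fq ξ n)

/-- The defining set for `w_n^{sep}` (separable polynomials only). -/
def wnsepSet (ξ : K Fq) (n : ℕ) : Set ℝ :=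
  {w | {P : Polynomial (Polynomial Fq) |
      P.Separable ∧ P.natDegree ≤ n ∧ 0 < absK Fq (evalK Fq P ξ) ∧
      absK Fq (evalK Fq P ξ) < HP Fq P ^ (-w)}.Infinite}

/-- The exponent `w_n^{sep}(ξ)`. -/
def wnsep (ξ : K Fq) (n : ℕ) : EReal :=
  sSup ((fun w : ℝ => (w : EReal)) '' wnsepSet Fq ξ n)

/-- The defining set for Koksma's exponent `w_n^*` (approximation by algebraic
elements lying in `F_q((T⁻¹))`). -/
def wnstarSet (ξ : K Fq) (n : ℕ) : Set ℝ :=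
  {w | {α : K Fq | IsAlgK Fq α ∧ degA Fq α ≤ n ∧ 0 < absK Fq (ξ - α) ∧
      absK Fq (ξ - α) < HA Fq α ^ (-w - 1)}.Infinite}

/-- Koksma's exponent `w_n^*(ξ)`. -/
def wnstar (ξ : K Fq) (n : ℕ) : EReal :=
  sSup ((fun w : ℝ => (w : EReal)) '' wnstarSet Fq ξ n)

/-- The defining set for the uniform exponent `ŵ_n`. -/
def hwnSet (ξ : K Fq) (n : ℕ) : Set ℝ :=
  {w | ∃ H0 : ℝ, ∀ H : ℝ, H0 < H → ∃ P : Polynomial (Polynomial Fq),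
      P.natDegree ≤ n ∧ HP Fq P ≤ H ∧ 0 < absK Fq (evalK Fq P ξ) ∧
      absK Fq (evalK Fq P ξ) < H ^ (-w)}

/-- The uniform exponent `ŵ_n(ξ)`. -/
def hwn (ξ : K Fq) (n : ℕ) : EReal :=
  sSup ((fun w : ℝ => (w : EReal)) '' hwnSet Fq ξ n)

/-- The defining set for the uniform exponent `ŵ_n^{sep}` (separable polynomials only). -/
def hwnsepSet (ξ : K Fq) (n : ℕ) : Set ℝ :=
  {w | ∃ H0 : ℝ, ∀ H : ℝ, H0 < H → ∃ P : Polynomial (Polynomial Fq),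
      P.Separable ∧ P.natDegree ≤ n ∧ HP Fq P ≤ H ∧ 0 < absK Fq (evalK Fq P ξ) ∧
      absK Fq (evalK Fq P ξ) < H ^ (-w)}

/-- The uniform exponent `ŵ_n^{sep}(ξ)`. -/
def hwnsep (ξ : K Fq) (n : ℕ) : EReal :=
  sSup ((fun w : ℝ => (w : EReal)) '' hwnsepSet Fq ξ n)

/-- The fractional part of a Laurent series in `T⁻¹`: the part with only
 negative powers of `T` (positive powers of the series variable `t = T⁻¹`). -/
def fracPart (η : K Fq) : K Fq :=
  { coeff := fun m => if 0 < m then η.coeff m else 0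
    isPWO_support' := η.isPWO_support'.mono (fun m hm => by
      by_cases h : 0 < m
      · simpa [Function.mem_support, h] using hm
      · simp [Function.mem_support, h] at hm) }

/-- The fractional-part norm `‖η‖ = |η - [η]|`. -/
def fracNorm (η : K Fq) : ℝ := absK Fq (fracPart Fq η)

/-- `max{‖R(T)ξ‖, …, ‖R(T)ξⁿ‖}`. -/
def maxFrac (ξ : K Fq) (n : ℕ) (R : Polynomial Fq) : ℝ :=
  sSup ((fun i => fracNorm Fq (emb Fq R * ξ ^ i)) '' Set.Icc 1 n)

/-- The defining set for the exponent of simultaneous approximation `λ_n`. -/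
def lamSet (ξ : K Fq) (n : ℕ) : Set ℝ :=
  {l | {R : Polynomial Fq | 0 < maxFrac Fq ξ n R ∧
      maxFrac Fq ξ n R < (Fintype.card Fq : ℝ) ^ (-(l * R.natDegree))}.Infinite}

/-- The exponent of simultaneous approximation `λ_n(ξ)`. -/
def lam (ξ : K Fq) (n : ℕ) : EReal :=
  sSup ((fun w : ℝ => (w : EReal)) '' lamSet Fq ξ n)

/-- The defining set for the uniform exponent `λ̂_n`. -/
def hlamSet (ξ : K Fq) (n : ℕ) : Set ℝ :=
  {l | ∃ d0 : ℕ, ∀ d : ℕ, d0 < d → ∃ R : Polynomial Fq, R.natDegree ≤ d ∧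
      0 < maxFrac Fq ξ n R ∧
      maxFrac Fq ξ n R < (Fintype.card Fq : ℝ) ^ (-(l * d))}

/-- The uniform exponent `λ̂_n(ξ)`. -/
def hlam (ξ : K Fq) (n : ℕ) : EReal :=
  sSup ((fun w : ℝ => (w : EReal)) '' hlamSet Fq ξ n)

/-- An algebraic closure of `F_q((T⁻¹))`; its algebraic elements are exactly the
algebraic elements of the completion `C_∞`. -/
abbrev Kbar := AlgebraicClosure (K Fq)

/-- The embedding of `F_q[T]` into the algebraic closure. -/
def embbar : Polynomial Fq →+* Kbar Fq :=
  (algebraMap (K Fq) (Kbar Fq)).comp (emb Fq)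

/-- Evaluation of `P ∈ F_q[T][X]` at a point of the algebraic closure. -/
def evalKbar (P : Polynomial (Polynomial Fq)) (x : Kbar Fq) : Kbar Fq :=
  P.eval₂ (embbar Fq) x

/-- The unique extension of the absolute value of `F_q((T⁻¹))` to its algebraic
closure: `|x| = |N(x)|^{1/d} = |a_0|^{1/d}` where `a_0` is the constant term and
`d` the degree of the minimal polynomial of `x` over `F_q((T⁻¹))`. -/
def absC (x : Kbar Fq) : ℝ :=
  absK Fq ((minpoly (K Fq) x).coeff 0) ^ ((1 : ℝ) / (minpoly (K Fq) x).natDegree)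

/-- `x ∈ C_∞` is algebraic over `F_q[T]`. -/
def IsAlgKbar (x : Kbar Fq) : Prop :=
  ∃ P : Polynomial (Polynomial Fq), P ≠ 0 ∧ evalKbar Fq P x = 0

/-- Degree over `F_q[T]` of an algebraic element of `C_∞`. -/
def degAbar (x : Kbar Fq) : ℕ :=
  sInf {d | ∃ P : Polynomial (Polynomial Fq), P ≠ 0 ∧ P.natDegree = d ∧ evalKbar Fq P x = 0}

/-- Height of an algebraic element of `C_∞`. -/
def HAbar (x : Kbar Fq) : ℝ :=
  sInf {h | ∃ P : Polynomial (Polynomial Fq),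
    P ≠ 0 ∧ P.natDegree = degAbar Fq x ∧ evalKbar Fq P x = 0 ∧ h = HP Fq P}

/-- The defining set for the exponent `w_n^@` (approximation by algebraic
elements of `C_∞`). -/
def wnAtSet (ξ : K Fq) (n : ℕ) : Set ℝ :=
  {w | {α : Kbar Fq | IsAlgKbar Fq α ∧ degAbar Fq α ≤ n ∧
      0 < absC Fq (algebraMap (K Fq) (Kbar Fq) ξ - α) ∧
      absC Fq (algebraMap (K Fq) (Kbar Fq) ξ - α) < HAbar Fq α ^ (-w - 1)}.Infinite}

/-- The exponent `w_n^@(ξ)`. -/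
def wnAt (ξ : K Fq) (n : ℕ) : EReal :=
  sSup ((fun w : ℝ => (w : EReal)) '' wnAtSet Fq ξ n)

/-- The defining set for the uniform exponent `ŵ_n^@`. -/
def hwnAtSet (ξ : K Fq) (n : ℕ) : Set ℝ :=
  {w | ∃ H0 : ℝ, ∀ H : ℝ, H0 < H → ∃ α : Kbar Fq, IsAlgKbar Fq α ∧ degAbar Fq α ≤ n ∧
      HAbar Fq α ≤ H ∧ 0 < absC Fq (algebraMap (K Fq) (Kbar Fq) ξ - α) ∧
      absC Fq (algebraMap (K Fq) (Kbar Fq) ξ - α) < (HAbar Fq α)⁻¹ * H ^ (-w)}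

/-- The uniform exponent `ŵ_n^@(ξ)`. -/
def hwnAt (ξ : K Fq) (n : ℕ) : EReal :=
  sSup ((fun w : ℝ => (w : EReal)) '' hwnAtSet Fq ξ n)

/-- `w(ξ) = limsup_n w_n(ξ)/n`. -/
def wlim (ξ : K Fq) : EReal :=
  Filter.atTop.limsup fun n : ℕ => wn Fq ξ n * (((n : ℝ)⁻¹ : ℝ) : EReal)

/-- `w^*(ξ) = limsup_n w_n^*(ξ)/n`. -/
def wlimstar (ξ : K Fq) : EReal :=
  Filter.atTop.limsup fun n : ℕ => wnstar Fq ξ n * (((n : ℝ)⁻¹ : ℝ) : EReal)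

/-- Height of a polynomial over `C_∞`: maximum of the absolute values of its
coefficients. -/
def HC (P : Polynomial (Kbar Fq)) : ℝ :=
  sSup ((fun i => absC Fq (P.coeff i)) '' Set.Iic P.natDegree)

lemma one_lt_q : (1 : ℝ) < (Fintype.card Fq : ℝ) := by
  exact_mod_cast Fintype.one_lt_card

lemma one_lt_q_nn : (1 : NNReal) < (Fintype.card Fq : NNReal) := by
  exact_mod_cast Fintype.one_lt_card

/-- rank one structure on the valuation of the Laurent series field, base `q`. -/
@[reducible]
def rankOneK : Valuation.RankOne (Valued.v : Valuation (LaurentSeries Fq) (WithZero (Multiplicative ℤ))) where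
  hom' := (WithZeroMulInt.toNNReal (one_lt_q_nn Fq).ne_zero).comp
    (MonoidWithZeroHom.ValueGroup₀.embedding)
  strictMono' := (WithZeroMulInt.toNNReal_strictMono (one_lt_q_nn Fq)).comp
    MonoidWithZeroHom.ValueGroup₀.embedding_strictMono
  exists_val_nontrivial := by
    refine ⟨HahnSeries.single 1 1, ?_⟩
    have := LaurentSeries.valuation_single_zpow Fq 1
    rw [this]
    refine ⟨by simp, ?_⟩
    rw [← WithZero.exp_zero]
    intro h
    simpa using WithZero.exp_injective h

@[reducible]
def normedK : NormedField (K Fq) :=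
  letI := rankOneK Fq
  Valued.toNormedField (LaurentSeries Fq) (WithZero (Multiplicative ℤ))

lemma v_eq (x : LaurentSeries Fq) (hx : x ≠ 0) :
    (Valued.v x : WithZero (Multiplicative ℤ)) = WithZero.exp (-(HahnSeries.order x)) := by
  apply le_antisymm
  · rw [LaurentSeries.valuation_le_iff_coeff_lt_eq_zero]
    intro n hn
    exact HahnSeries.coeff_eq_zero_of_lt_order hn
  · by_contra h
    push Not at h
    have h0 : (Valued.v x : WithZero (Multiplicative ℤ)) ≠ 0 := by simpa using hx
    have h2 : (Valued.v x : WithZero (Multiplicative ℤ)) ≤ WithZero.exp (-(HahnSeries.order x + 1)) := by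
      rw [← WithZero.exp_log h0] at h ⊢
      rw [WithZero.exp_lt_exp] at h
      rw [WithZero.exp_le_exp]
      omega
    rw [LaurentSeries.valuation_le_iff_coeff_lt_eq_zero] at h2
    exact HahnSeries.coeff_order_eq_zero.not.mpr hx (h2 _ (by omega))

lemma norm_eq_absK (x : K Fq) : (normedK Fq).toNorm.norm x = absK Fq x := by
  letI := rankOneK Fq
  have : (normedK Fq).toNorm.norm x = (WithZeroMulInt.toNNReal (one_lt_q_nn Fq).ne_zero (Valued.v x) : ℝ) := by
    change ((Valuation.RankOne.hom _ (Valued.v.restrict x) : NNReal) : ℝ) = _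
    change (((WithZeroMulInt.toNNReal (one_lt_q_nn Fq).ne_zero) (MonoidWithZeroHom.ValueGroup₀.embedding (Valued.v.restrict x)) : NNReal) : ℝ) = _
    simp
  rw [this, absK]
  split_ifs with h
  · simp [h]
  · rw [v_eq Fq x h, WithZeroMulInt.toNNReal_neg_apply _ (by simp)]
    simp only [NNReal.coe_zpow, NNReal.coe_natCast]
    congr 1


@[reducible]
def nnormedK : NontriviallyNormedField (K Fq) where
  toNormedField := normedK Fq
  non_trivial := by
    refine ⟨HahnSeries.single (-1) 1, ?_⟩
    rw [norm_eq_absK, absK, if_neg (by simp), HahnSeries.order_single (by simp)]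
    simpa using one_lt_q Fq

lemma absC_facts : (∀ x, 0 ≤ absC Fq x) ∧ (∀ x y, absC Fq (x * y) = absC Fq x * absC Fq y) ∧
    (∀ x y, absC Fq (x + y) ≤ max (absC Fq x) (absC Fq y)) ∧
    (∀ x, absC Fq (-x) = absC Fq x) ∧
    (∀ x, absC Fq x = 0 ↔ x = 0) ∧
    (∀ x, absC Fq (algebraMap (K Fq) (Kbar Fq) x) = absK Fq x) := by
  letI := rankOneK Fq
  letI := nnormedK Fq
  haveI : CompleteSpace (K Fq) := LaurentSeries.instLaurentSeriesComplete
  haveI : IsUltrametricDist (K Fq) := by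
    exact Valued.instIsUltrametricDist (LaurentSeries Fq) (WithZero (Multiplicative ℤ))
  have key : ∀ x, absC Fq x = spectralMulAlgNorm (K Fq) (Kbar Fq) x := by
    intro x
    rw [spectralMulAlgNorm_def, spectralNorm.spectralNorm_eq_norm_coeff_zero_rpow]
    rw [absC, ← norm_eq_absK]
  refine ⟨fun x => ?_, fun x y => ?_, fun x y => ?_, fun x => ?_, fun x => ?_, fun x => ?_⟩
  · rw [key]; exact apply_nonneg _ _
  · simp only [key]; exact map_mul _ _ _
  · simp only [key]; exact isNonarchimedean_spectralNorm x y
  · simp only [key]; exact map_neg_eq_map _ _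
  · simp only [key]; exact map_eq_zero_iff_eq_zero _
  · simp only [key]
    rw [← norm_eq_absK]
    exact spectralNorm_extends x

/-- `absC` as a bundled absolute value. -/
def avC : AbsoluteValue (Kbar Fq) ℝ where
  toFun := absC Fq
  map_mul' := (absC_facts Fq).2.1
  nonneg' := (absC_facts Fq).1
  eq_zero' := (absC_facts Fq).2.2.2.2.1
  add_le' x y := ((absC_facts Fq).2.2.1 x y).trans
    (max_le_add_of_nonneg ((absC_facts Fq).1 x) ((absC_facts Fq).1 y))

lemma avC_apply (x : Kbar Fq) : avC Fq x = absC Fq x := rfl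

lemma avC_nonarch : IsNonarchimedean (avC Fq) := (absC_facts Fq).2.2.1

lemma avC_algebraMap (x : K Fq) : avC Fq (algebraMap (K Fq) (Kbar Fq) x) = absK Fq x :=
  (absC_facts Fq).2.2.2.2.2 x

section abstract
variable {L : Type*} [Field L] (v : AbsoluteValue L ℝ)

lemma multiset_coeff_bound (hv : IsNonarchimedean v) (ρ : ℝ) (hρ : 0 < ρ) (s : Multiset L) (hs : ∀ a ∈ s, ρ ≤ v a) (k : ℕ) :
    v ((s.map fun a => X - C a).prod.coeff k) * ρ ^ k ≤ v ((s.map fun a => X - C a).prod.coeff 0) := by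
  induction s using Multiset.induction_on generalizing k with
  | empty =>
    rcases k with _ | k
    · simp
    · simp [coeff_one]
  | cons a s ih =>
    have ih := fun k => ih (fun b hb => hs b (Multiset.mem_cons_of_mem hb)) k
    have ha := hs a (Multiset.mem_cons_self a s)
    simp only [Multiset.map_cons, Multiset.prod_cons]
    set g := (s.map fun a => X - C a).prod
    have h0 : ((X - C a) * g).coeff 0 = - (a * g.coeff 0) := by simp [sub_mul]
    rw [h0, map_neg_eq_map, map_mul]
    rcases k with _ | k
    · rw [h0]; simp
    · have h1 : ((X - C a) * g).coeff (k + 1) = g.coeff k + -(a * g.coeff (k+1)) := by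
        rw [sub_mul, coeff_sub, coeff_X_mul, coeff_C_mul, sub_eq_add_neg]
      rw [h1]
      have h2 := hv (g.coeff k) (-(a * g.coeff (k+1)))
      rw [map_neg_eq_map, map_mul] at h2
      have hp : 0 ≤ ρ ^ (k+1) := by positivity
      refine (mul_le_mul_of_nonneg_right h2 hp).trans ?_
      rw [max_mul_of_nonneg _ _ hp]
      apply max_le
      · rw [pow_succ, ← mul_assoc, mul_comm]
        exact mul_le_mul ha (ih k) (by positivity) (by positivity)
      · rw [mul_assoc]
        exact mul_le_mul_of_nonneg_left (ih (k+1)) (by positivity)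

lemma splits_coeff_bound (hv : IsNonarchimedean v) (ρ : ℝ) (hρ : 0 < ρ) (f : L[X]) (hf : f.Splits)
    (hs : ∀ a ∈ f.roots, ρ ≤ v a) (k : ℕ) :
    v (f.coeff k) * ρ ^ k ≤ v (f.coeff 0) := by
  rw [hf.eq_prod_roots]
  simp only [coeff_C_mul, map_mul]
  rw [mul_assoc]
  exact mul_le_mul_of_nonneg_left (multiset_coeff_bound v hv ρ hρ _ hs k) (by positivity)

lemma det_le (hv : IsNonarchimedean v) {N : ℕ} (M : Matrix (Fin N) (Fin N) L) (B : ℝ) 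
    (h : ∀ σ : Equiv.Perm (Fin N), ∏ i, v (M i (σ i)) ≤ B) : v M.det ≤ B := by
  rw [← Matrix.det_transpose, Matrix.det_apply]
  have hne : (Finset.univ : Finset (Equiv.Perm (Fin N))).Nonempty := Finset.univ_nonempty
  obtain ⟨σ, -, hσ⟩ := hv.finset_image_add_of_nonempty
    (fun σ : Equiv.Perm (Fin N) => Equiv.Perm.sign σ • ∏ i, M.transpose (σ i) i) hne
  refine hσ.trans (le_trans (le_of_eq ?_) (h σ))
  rcases Int.units_eq_one_or (Equiv.Perm.sign σ) with h1 | h1 <;> 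
    simp [h1, map_prod]

lemma det_bound3 (hv : IsNonarchimedean v) {N : ℕ} (hN : 3 ≤ N) (M : Matrix (Fin N) (Fin N) L) (s : Fin N → ℕ) (t : Fin N → Bool)
    (hst : ∀ i j, s i = s j → t i = t j → i = j) (A δ ε ρ : ℝ) (hρ : 0 < ρ)
    (hδ : 0 ≤ δ) (hδε : δ ≤ ε) (hA : 0 ≤ A)
    (hM : ∀ i j, M i j = 0 ∨ ∃ k, k + s j = i ∧ v (M i j) ≤ A ∧ 
      v (M i j) * ρ ^ k ≤ if t j then δ else ε) :
    v M.det * ρ ^ 2 ≤ max (ε ^ 2 * A ^ (N - 2) * ρ ^ 2) (δ * ε ^ 2 * A ^ (N - 3)) := by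
  rw [← le_div_iff₀ (by positivity)]
  apply det_le v hv
  intro σ
  rw [le_div_iff₀ (by positivity)]
  obtain ⟨N, rfl⟩ := Nat.exists_eq_add_of_le' hN
  have hε : 0 ≤ ε := hδ.trans hδε
  have hnn : 0 ≤ max (ε ^ 2 * A ^ (N + 3 - 2) * ρ ^ 2) (δ * ε ^ 2 * A ^ (N + 3 - 3)) := 
    le_max_of_le_left (by positivity)
  by_cases hz : ∃ i, M i (σ i) = 0
  · obtain ⟨i, hi⟩ := hz
    rw [Finset.prod_eq_zero (Finset.mem_univ i) (by simp [hi]), zero_mul]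
    exact hnn
  push Not at hz
  have hM' : ∀ i, ∃ k, k + s (σ i) = i ∧ v (M i (σ i)) ≤ A ∧ 
      v (M i (σ i)) * ρ ^ k ≤ if t (σ i) then δ else ε := fun i => (hM i (σ i)).resolve_left (hz i)
  rw [Fin.prod_univ_succ, Fin.prod_univ_succ, Fin.prod_univ_succ]
  have hrest : ∏ i : Fin N, v (M i.succ.succ.succ (σ i.succ.succ.succ)) ≤ A ^ N := by
    refine (Finset.prod_le_prod (fun i _ => by positivity) 
      (fun i _ => (hM' i.succ.succ.succ).choose_spec.2.1)).trans ?_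
    simp
  set R := ∏ i : Fin N, v (M i.succ.succ.succ (σ i.succ.succ.succ)) with hR
  have hR0 : 0 ≤ R := Finset.prod_nonneg (fun i _ => by positivity)
  have hle : ∀ j, (if t j then δ else ε) ≤ ε := by intro j; split_ifs <;> [exact hδε; exact le_rfl]
  obtain ⟨k0, hk0, hA0, hb0⟩ := hM' 0
  obtain ⟨k1, hk1, hA1, hb1⟩ := hM' (Fin.succ 0)
  obtain ⟨k2, hk2, hA2, hb2⟩ := hM' (Fin.succ (Fin.succ 0))
  have n01 : ¬ (s (σ 0) = s (σ (Fin.succ 0)) ∧ t (σ 0) = t (σ (Fin.succ 0))) := by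
    rintro ⟨h1, h2⟩
    have := congrArg Fin.val (σ.injective (hst _ _ h1 h2))
    simp only [Fin.val_succ, Fin.val_zero] at this
    omega
  have n02 : ¬ (s (σ 0) = s (σ (Fin.succ (Fin.succ 0))) ∧ t (σ 0) = t (σ (Fin.succ (Fin.succ 0)))) := by
    rintro ⟨h1, h2⟩
    have := congrArg Fin.val (σ.injective (hst _ _ h1 h2))
    simp only [Fin.val_succ, Fin.val_zero] at this
    omega
  have n12 : ¬ (s (σ (Fin.succ 0)) = s (σ (Fin.succ (Fin.succ 0))) ∧ t (σ (Fin.succ 0)) = t (σ (Fin.succ (Fin.succ 0)))) := by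
    rintro ⟨h1, h2⟩
    have := congrArg Fin.val (σ.injective (hst _ _ h1 h2))
    simp only [Fin.val_succ, Fin.val_zero] at this
    omega
  have e0 := hle (σ 0)
  have e1 := hle (σ (Fin.succ 0))
  have e2 := hle (σ (Fin.succ (Fin.succ 0)))
  generalize σ 0 = j0 at *
  generalize σ (Fin.succ 0) = j1 at *
  generalize σ (Fin.succ (Fin.succ 0)) = j2 at *
  have a0 : 0 ≤ v (M 0 j0) := by positivity
  have a1 : 0 ≤ v (M (Fin.succ 0) j1) := by positivity
  have a2 : 0 ≤ v (M (Fin.succ (Fin.succ 0)) j2) := by positivity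
  generalize v (M 0 j0) = x0 at *
  generalize v (M (Fin.succ 0) j1) = x1 at *
  generalize v (M (Fin.succ (Fin.succ 0)) j2) = x2 at *
  simp only [Fin.val_succ, Fin.val_zero] at hk0 hk1 hk2
  have hk00 : k0 = 0 := by omega
  subst hk00
  have hN2 : N + 3 - 2 = N + 1 := by omega
  have hN3 : N + 3 - 3 = N := by omega
  rw [hN2, hN3]
  rw [pow_zero, mul_one] at hb0
  by_cases c1 : k1 = 0
  · subst c1
    rw [pow_zero, mul_one] at hb1
    apply le_max_of_le_left
    gcongr ?_ * _
    calc x0 * (x1 * (x2 * R)) ≤ ε * (ε * (A * A ^ N)) := by gcongr <;> linarith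
      _ = _ := by ring
  have hk11 : k1 = 1 := by omega
  subst hk11
  by_cases c2 : k2 = 0
  · subst c2
    rw [pow_zero, mul_one] at hb2
    apply le_max_of_le_left
    gcongr ?_ * _
    calc x0 * (x1 * (x2 * R)) ≤ ε * (A * (ε * A ^ N)) := by gcongr <;> linarith
      _ = _ := by ring
  have hk21 : k2 = 1 := by
    by_contra hne
    have hk22 : k2 = 2 := by omega
    have h1 : ¬ t j0 = t j1 := fun h => n01 ⟨by omega, h⟩
    have h2 : ¬ t j0 = t j2 := fun h => n02 ⟨by omega, h⟩
    have h3 : ¬ t j1 = t j2 := fun h => n12 ⟨by omega, h⟩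
    revert h1 h2 h3
    cases t j0 <;> cases t j1 <;> cases t j2 <;> simp
  subst hk21
  have h1 : ¬ t j0 = t j1 := fun h => n01 ⟨by omega, h⟩
  apply le_max_of_le_right
  rw [pow_one] at hb1 hb2
  have hx2 : x2 * ρ ≤ ε := hb2.trans e2
  have hx01 : x0 * (x1 * ρ) ≤ δ * ε := by
    have h0 : 0 ≤ x1 * ρ := by positivity
    rcases hj0 : t j0 with _ | _ <;> rcases hj1 : t j1 with _ | _ <;> simp [hj0, hj1] at h1 hb0 hb1
    · rw [mul_comm δ ε]; exact mul_le_mul hb0 hb1 h0 hε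
    · exact mul_le_mul hb0 hb1 h0 hδ
  calc x0 * (x1 * (x2 * R)) * ρ ^ 2 = (x0 * (x1 * ρ)) * (x2 * ρ) * R := by ring
    _ ≤ (δ * ε) * ε * A ^ N := by gcongr
    _ = _ := by ring

lemma det_bound2 (hv : IsNonarchimedean v) {N : ℕ} (hN : N = 2) (M : Matrix (Fin N) (Fin N) L) (s : Fin N → ℕ) (t : Fin N → Bool)
    (hst : ∀ i j, s i = s j → t i = t j → i = j) (A δ ε ρ : ℝ) (hρ : 0 < ρ)
    (hδ : 0 ≤ δ) (hδε : δ ≤ ε) 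
    (hM : ∀ i j, M i j = 0 ∨ ∃ k, k + s j = i ∧ v (M i j) ≤ A ∧ 
      v (M i j) * ρ ^ k ≤ if t j then δ else ε) :
    v M.det * ρ ≤ max (ε ^ 2 * ρ) (δ * ε) := by
  subst hN
  rw [← le_div_iff₀ (by positivity)]
  apply det_le v hv
  intro σ
  rw [le_div_iff₀ (by positivity)]
  have hε : 0 ≤ ε := hδ.trans hδε
  by_cases hz : ∃ i, M i (σ i) = 0
  · obtain ⟨i, hi⟩ := hz
    rw [Finset.prod_eq_zero (Finset.mem_univ i) (by simp [hi]), zero_mul]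
    exact le_max_of_le_left (by positivity)
  push Not at hz
  have hM' : ∀ i, ∃ k, k + s (σ i) = i ∧ v (M i (σ i)) ≤ A ∧ 
      v (M i (σ i)) * ρ ^ k ≤ if t (σ i) then δ else ε := fun i => (hM i (σ i)).resolve_left (hz i)
  rw [Fin.prod_univ_two]
  have hle : ∀ j, (if t j then δ else ε) ≤ ε := by intro j; split_ifs <;> [exact hδε; exact le_rfl]
  obtain ⟨k0, hk0, hA0, hb0⟩ := hM' 0
  obtain ⟨k1, hk1, hA1, hb1⟩ := hM' 1
  have n01 : ¬ (s (σ 0) = s (σ 1) ∧ t (σ 0) = t (σ 1)) := by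
    rintro ⟨h1, h2⟩
    have := σ.injective (hst _ _ h1 h2)
    simp at this
  have e0 := hle (σ 0)
  have e1 := hle (σ 1)
  generalize σ 0 = j0 at *
  generalize σ 1 = j1 at *
  have a0 : 0 ≤ v (M 0 j0) := by positivity
  have a1 : 0 ≤ v (M 1 j1) := by positivity
  generalize v (M 0 j0) = x0 at *
  generalize v (M 1 j1) = x1 at *
  simp only [Fin.val_one, Fin.val_zero] at hk0 hk1
  have hk00 : k0 = 0 := by omega
  subst hk00
  rw [pow_zero, mul_one] at hb0
  by_cases c1 : k1 = 0
  · subst c1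
    rw [pow_zero, mul_one] at hb1
    apply le_max_of_le_left
    gcongr ?_ * _
    calc x0 * x1 ≤ ε * ε := by gcongr <;> linarith
      _ = _ := by ring
  have hk11 : k1 = 1 := by omega
  subst hk11
  have h1 : ¬ t j0 = t j1 := fun h => n01 ⟨by omega, h⟩
  apply le_max_of_le_right
  rw [pow_one] at hb1
  have h0 : 0 ≤ x1 * ρ := by positivity
  rw [mul_assoc]
  rcases hj0 : t j0 with _ | _ <;> rcases hj1 : t j1 with _ | _ <;> simp [hj0, hj1] at h1 hb0 hb1
  · rw [mul_comm δ ε]; exact mul_le_mul hb0 hb1 h0 hε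
  · exact mul_le_mul hb0 hb1 h0 hδ

/-- the data of the Sylvester matrix used in the determinant bounds -/
lemma sylvester_data (f g : L[X]) (m n : ℕ) (A δ ε ρ : ℝ) 
    (hfA : ∀ k, v (f.coeff k) ≤ A) (hgA : ∀ k, v (g.coeff k) ≤ A)
    (hf : ∀ k, v (f.coeff k) * ρ ^ k ≤ δ) (hg : ∀ k, v (g.coeff k) * ρ ^ k ≤ ε) :
    ∃ (s : Fin (m + n) → ℕ) (t : Fin (m + n) → Bool), 
    (∀ i j, s i = s j → t i = t j → i = j) ∧
    (∀ i j, sylvester f g m n i j = 0 ∨ ∃ k, k + s j = i ∧ v (sylvester f g m n i j) ≤ A ∧ 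
      v (sylvester f g m n i j) * ρ ^ k ≤ if t j then δ else ε) := by
  refine ⟨fun j => j.addCases (fun a => (a : ℕ)) (fun b => (b : ℕ)), 
    fun j => j.addCases (fun _ => false) (fun _ => true), ?_, ?_⟩
  · intro i j
    induction i using Fin.addCases <;> induction j using Fin.addCases <;> 
      simp [Fin.ext_iff]
  · intro i j
    induction j using Fin.addCases with
    | left j =>
      simp only [sylvester, Matrix.of_apply, Fin.addCases_left]
      by_cases h : (i : ℕ) ∈ Set.Icc (j : ℕ) (j + n)
      · rw [if_pos h]
        right
        simp only [Set.mem_Icc] at h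
        exact ⟨i - j, by omega, hgA _, by simpa using hg _⟩
      · rw [if_neg h]; left; rfl
    | right j =>
      simp only [sylvester, Matrix.of_apply, Fin.addCases_right]
      by_cases h : (i : ℕ) ∈ Set.Icc (j : ℕ) (j + m)
      · rw [if_pos h]
        right
        simp only [Set.mem_Icc] at h
        exact ⟨i - j, by omega, hfA _, by simpa using hf _⟩
      · rw [if_neg h]; left; rfl

end abstract

lemma Tvar_pow (k : ℕ) : Tvar Fq ^ k = HahnSeries.single (-(k : ℤ)) 1 := by
  rw [Tvar, HahnSeries.single_pow]; simp

lemma emb_coeff (p : Polynomial Fq) (m : ℤ) :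
    (emb Fq p).coeff m = if m ≤ 0 then p.coeff (-m).toNat else 0 := by
  have h : ∀ a : Fq, algebraMap Fq (K Fq) a = HahnSeries.C a := by
    intro a; exact LaurentSeries.algebraMap_apply Fq a
  induction p using Polynomial.induction_on' with
  | add p r hp hr => 
    rw [map_add, HahnSeries.coeff_add, hp, hr]
    split_ifs <;> simp
  | monomial k a =>
    rw [emb, coe_eval₂RingHom, eval₂_monomial, Tvar_pow, h, HahnSeries.C_apply, HahnSeries.single_mul_single]
    rw [HahnSeries.coeff_single, coeff_monomial]
    split_ifs <;> first | omega | simp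

lemma absK_le_of_coeff (x : K Fq) (D : ℤ) (h : ∀ m < D, x.coeff m = 0) :
    absK Fq x ≤ (Fintype.card Fq : ℝ) ^ (-D) := by
  have hq := one_lt_q Fq
  rw [absK]
  split_ifs with hx
  · positivity
  · apply zpow_le_zpow_right₀ hq.le
    have : D ≤ x.order := by
      by_contra hlt
      push Not at hlt
      exact hx (HahnSeries.coeff_order_eq_zero.1 (h _ hlt))
    omega

lemma absK_emb (p : Polynomial Fq) (hp : p ≠ 0) : 
    absK Fq (emb Fq p) = (Fintype.card Fq : ℝ) ^ p.natDegree := by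
  have hc : (emb Fq p).coeff (-(p.natDegree : ℤ)) ≠ 0 := by
    rw [emb_coeff]; simpa using hp
  have hne : emb Fq p ≠ 0 := by
    intro h; rw [h] at hc; simp at hc
  have ho : (emb Fq p).order = -(p.natDegree : ℤ) := by
    apply le_antisymm
    · exact HahnSeries.order_le_of_coeff_ne_zero hc
    · by_contra hlt
      push Not at hlt
      apply hne
      rw [← HahnSeries.coeff_order_eq_zero]
      rw [emb_coeff]
      split_ifs
      · apply coeff_eq_zero_of_natDegree_lt; omega
      · rfl
  rw [absK, if_neg hne, ho]; simp

lemma emb_injective : Function.Injective (emb Fq) := by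
  rw [injective_iff_map_eq_zero]
  intro p hp
  by_contra h
  have := absK_emb Fq p h
  rw [hp, absK] at this
  have hq := one_lt_q Fq
  have : (0:ℝ) < (Fintype.card Fq : ℝ) ^ p.natDegree := by positivity
  simp_all

lemma embbar_injective : Function.Injective (embbar Fq) :=
  (algebraMap (K Fq) (Kbar Fq)).injective.comp (emb_injective Fq)

lemma avC_embbar (p : Polynomial Fq) (hp : p ≠ 0) : 
    avC Fq (embbar Fq p) = (Fintype.card Fq : ℝ) ^ p.natDegree := by
  rw [← absK_emb Fq p hp, ← avC_algebraMap]; rfl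

lemma one_le_avC_embbar (p : Polynomial Fq) (hp : p ≠ 0) : 1 ≤ avC Fq (embbar Fq p) := by
  rw [avC_embbar Fq p hp]
  exact one_le_pow₀ (one_lt_q Fq).le

lemma evalKbar_alg (P : Polynomial (Polynomial Fq)) (ξ : K Fq) :
    evalKbar Fq P (algebraMap (K Fq) (Kbar Fq) ξ) = algebraMap _ _ (evalK Fq P ξ) := by
  rw [evalKbar, evalK, embbar, hom_eval₂]

lemma absK_evalK (P : Polynomial (Polynomial Fq)) (ξ : K Fq) :
    absK Fq (evalK Fq P ξ) = avC Fq (evalKbar Fq P (algebraMap (K Fq) (Kbar Fq) ξ)) := by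
  rw [evalKbar_alg, avC_algebraMap]

/-- log-height -/
def hd (P : Polynomial (Polynomial Fq)) : ℕ := P.support.sup fun i => (P.coeff i).natDegree

lemma HP_eq (P : Polynomial (Polynomial Fq)) : HP Fq P = (Fintype.card Fq : ℝ) ^ hd Fq P := rfl

lemma natDegree_le_hd (P : Polynomial (Polynomial Fq)) (i : ℕ) : (P.coeff i).natDegree ≤ hd Fq P := by
  by_cases h : P.coeff i = 0
  · simp [h]
  · exact Finset.le_sup (f := fun i => (P.coeff i).natDegree) (mem_support_iff.2 h)

lemma hd_le (P : Polynomial (Polynomial Fq)) (h : ℕ) (H : ∀ i, (P.coeff i).natDegree ≤ h) : hd Fq P ≤ h :=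
  Finset.sup_le fun i _ => H i

lemma swap_coeff (P : Polynomial (Polynomial Fq)) (i j : ℕ) : 
    ((Polynomial.Bivariate.swap P).coeff i).coeff j = (P.coeff j).coeff i := by
  induction P using Polynomial.induction_on' with
  | add p r hp hr => simp [hp, hr]
  | monomial k a =>
    induction a using Polynomial.induction_on' with
    | add p r hp hr => simp only [map_add, coeff_add, hp, hr]
    | monomial l b => 
      rw [Bivariate.swap_monomial_monomial]
      simp only [coeff_monomial]
      split_ifs <;> simp_all [coeff_monomial]

lemma hd_eq (P : Polynomial (Polynomial Fq)) : hd Fq P = (Polynomial.Bivariate.swap P).natDegree := by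
  apply le_antisymm
  · apply hd_le
    intro i
    rw [natDegree_le_iff_coeff_eq_zero]
    intro N hN
    rw [← swap_coeff, coeff_eq_zero_of_natDegree_lt hN, coeff_zero]
  · rw [natDegree_le_iff_coeff_eq_zero]
    intro N hN
    ext j
    rw [swap_coeff, coeff_zero]
    exact coeff_eq_zero_of_natDegree_lt ((natDegree_le_hd Fq P j).trans_lt hN)

lemma hd_mul (P Q : Polynomial (Polynomial Fq)) (hP : P ≠ 0) (hQ : Q ≠ 0) :
    hd Fq (P * Q) = hd Fq P + hd Fq Q := by
  rw [hd_eq, hd_eq, hd_eq, map_mul, natDegree_mul] <;> simpa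

lemma HP_mul (P Q : Polynomial (Polynomial Fq)) (hP : P ≠ 0) (hQ : Q ≠ 0) :
    HP Fq (P * Q) = HP Fq P * HP Fq Q := by
  rw [HP_eq, HP_eq, HP_eq, hd_mul Fq P Q hP hQ, pow_add]

lemma one_le_HP (P : Polynomial (Polynomial Fq)) : 1 ≤ HP Fq P := one_le_pow₀ (one_lt_q Fq).le

lemma HP_le_of_dvd (P Q : Polynomial (Polynomial Fq)) (hQ : Q ≠ 0) (h : P ∣ Q) : HP Fq P ≤ HP Fq Q := by
  obtain ⟨R, rfl⟩ := h
  rw [HP_mul Fq _ _ (left_ne_zero_of_mul hQ) (right_ne_zero_of_mul hQ)]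
  exact le_mul_of_one_le_right (zero_le_one.trans (one_le_HP Fq P)) (one_le_HP Fq R)

lemma avC_coeff_le (P : Polynomial (Polynomial Fq)) (k : ℕ) : avC Fq (embbar Fq (P.coeff k)) ≤ HP Fq P := by
  by_cases h : P.coeff k = 0
  · rw [h]; simp [zero_le_one.trans (one_le_HP Fq P)]
  · rw [avC_embbar Fq _ h, HP_eq]
    exact pow_le_pow_right₀ (one_lt_q Fq).le (natDegree_le_hd Fq P k)

/-- polynomials of bounded degree and height are finite in number -/
lemma finite_bdd (n h : ℕ) : {P : Polynomial (Polynomial Fq) | P.natDegree ≤ n ∧ hd Fq P ≤ h}.Finite := by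
  have hinj : Function.Injective (fun (P : {P : Polynomial (Polynomial Fq) | P.natDegree ≤ n ∧ hd Fq P ≤ h}) 
      (x : Fin (n+1) × Fin (h+1)) => (P.1.coeff x.1).coeff x.2) := by
    intro P Q hPQ
    apply Subtype.ext
    ext i j
    by_cases hi : i ≤ n
    · by_cases hj : j ≤ h
      · exact congrFun hPQ (⟨i, by omega⟩, ⟨j, by omega⟩)
      · rw [coeff_eq_zero_of_natDegree_lt, coeff_eq_zero_of_natDegree_lt]
        · exact (natDegree_le_hd Fq _ _).trans_lt (by have := Q.2.2; omega)
        · exact (natDegree_le_hd Fq _ _).trans_lt (by have := P.2.2; omega)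
    · rw [coeff_eq_zero_of_natDegree_lt (p := P.1) (by have := P.2.1; omega),
        coeff_eq_zero_of_natDegree_lt (p := Q.1) (by have := Q.2.1; omega)]
  exact Set.finite_coe_iff.1 (Finite.of_injective _ hinj)

lemma taylor_bound {L : Type*} [Field L] (v : AbsoluteValue L ℝ) (hv : IsNonarchimedean v)
    (f : L[X]) (n : ℕ) (hn : f.natDegree ≤ n) (H : ℝ) (hH : ∀ k, v (f.coeff k) ≤ H) (r : L) (k : ℕ) :
    v ((taylor r f).coeff k) ≤ H * (max 1 (v r)) ^ n := by
  have hH0 : 0 ≤ H := (v.nonneg _).trans (hH 0)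
  have h1 : 1 ≤ max 1 (v r) := le_max_left _ _
  rw [taylor_coeff, eval_eq_sum_range]
  obtain ⟨i, hi, hle⟩ := hv.finset_image_add_of_nonempty
    (fun i => (hasseDeriv k f).coeff i * r ^ i) (t := Finset.range ((hasseDeriv k f).natDegree + 1)) (by simp)
  refine hle.trans ?_
  rw [hasseDeriv_coeff, map_mul, map_mul, map_pow]
  have hnat : v (((i + k).choose k : ℕ) : L) ≤ 1 := hv.apply_natCast_le_one 
  have hi' : i ≤ n := by
    have h2 := natDegree_hasseDeriv_le f k
    have := Finset.mem_range.1 hi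
    omega
  apply mul_le_mul
  · calc _ ≤ 1 * H := mul_le_mul hnat (hH _) (v.nonneg _) zero_le_one
      _ = H := one_mul H
  · calc v r ^ i ≤ (max 1 (v r)) ^ i := pow_le_pow_left₀ (v.nonneg _) (le_max_right _ _) _
      _ ≤ _ := pow_le_pow_right₀ h1 hi'
  · exact pow_nonneg (v.nonneg _) _
  · exact hH0

lemma resultant_ne (P Q : Polynomial (Polynomial Fq)) (hP : Irreducible P) (hd : 1 ≤ P.natDegree)
    (hQ : ¬ P ∣ Q) : resultant P Q ≠ 0 := by
  have hprim : P.IsPrimitive := hP.isPrimitive (by omega)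
  have hirr := (hprim.irreducible_iff_irreducible_map_fraction_map (K := RatFunc Fq)).1 hP
  have hinj : Function.Injective (algebraMap (Polynomial Fq) (RatFunc Fq)) := 
    IsFractionRing.injective _ _
  have hnd : ¬ P.map (algebraMap _ (RatFunc Fq)) ∣ Q.map (algebraMap _ (RatFunc Fq)) := by
    intro h
    exact hQ (hprim.dvd_of_fraction_map_dvd_fraction_map h)
  have hcop := (hirr.coprime_iff_not_dvd).2 hnd
  have := resultant_ne_zero _ _ hcop
  rw [natDegree_map_eq_of_injective hinj, natDegree_map_eq_of_injective hinj, resultant_map_map] at this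
  intro h0
  rw [h0] at this
  simp at this

lemma dvd_of_root (R M : Polynomial (Polynomial Fq)) (hR : Irreducible R) (hd : 1 ≤ R.natDegree)
    (α : Kbar Fq) (h1 : evalKbar Fq R α = 0) (h2 : evalKbar Fq M α = 0) : R ∣ M := by
  by_contra h
  have hres := resultant_ne Fq R M hR hd h
  obtain ⟨p, q, -, -, hpq⟩ := exists_mul_add_mul_eq_C_resultant R M (m := R.natDegree) (n := M.natDegree) le_rfl le_rfl (by omega)
  have := congrArg (fun F => evalKbar Fq F α) hpq
  simp only [evalKbar, eval₂_add, eval₂_mul, eval₂_C] at this h1 h2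
  rw [h1, h2] at this
  simp only [zero_mul, mul_zero, add_zero] at this
  exact hres (embbar_injective Fq (by rw [map_zero]; exact this.symm))

lemma exists_irred_factor (P : Polynomial (Polynomial Fq)) (hP : P ≠ 0) (α : Kbar Fq) (h : evalKbar Fq P α = 0) :
    ∃ R, Irreducible R ∧ R ∣ P ∧ 1 ≤ R.natDegree ∧ evalKbar Fq R α = 0 := by
  induction P using UniqueFactorizationMonoid.induction_on_prime with
  | h₁ => exact absurd rfl hP
  | h₂ x hx => 
    exfalso
    obtain ⟨c, hc, rfl⟩ := Polynomial.isUnit_iff.1 hx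
    rw [evalKbar, eval₂_C, map_eq_zero_iff _ (embbar_injective Fq)] at h
    exact hP (by simp [h])
  | h₃ a p ha hp ih =>
    have h' : evalKbar Fq p α * evalKbar Fq a α = 0 := by
      rw [← h]; simp [evalKbar, eval₂_mul]
    rcases mul_eq_zero.1 h' with h1 | h1
    · refine ⟨p, hp.irreducible, dvd_mul_right _ _, ?_, h1⟩
      by_contra hlt
      obtain ⟨c, rfl⟩ := natDegree_eq_zero.1 (show p.natDegree = 0 by omega)
      rw [evalKbar, eval₂_C, map_eq_zero_iff _ (embbar_injective Fq)] at h1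
      exact hp.ne_zero (by simp [h1])
    · obtain ⟨R, hR, hd, h3⟩ := ih ha h1
      exact ⟨R, hR, hd.mul_left _, h3⟩

lemma height_facts (P : Polynomial (Polynomial Fq)) (hP : P ≠ 0) (α : Kbar Fq) (h : evalKbar Fq P α = 0) :
    IsAlgKbar Fq α ∧ degAbar Fq α ≤ P.natDegree ∧ HAbar Fq α ≤ HP Fq P ∧ 1 ≤ HAbar Fq α := by
  obtain ⟨R, hR, hRP, hd, hRα⟩ := exists_irred_factor Fq P hP α h
  have hdeg : degAbar Fq α = R.natDegree := by
    apply le_antisymm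
    · exact Nat.sInf_le ⟨R, hR.ne_zero, rfl, hRα⟩
    · refine le_csInf (Set.nonempty_of_mem (x := R.natDegree) ⟨R, hR.ne_zero, rfl, hRα⟩) ?_
      rintro d ⟨M, hM, rfl, hMα⟩
      exact natDegree_le_of_dvd (dvd_of_root Fq R M hR hd α hRα hMα) hM
  refine ⟨⟨P, hP, h⟩, Nat.sInf_le ⟨P, hP, rfl, h⟩, ?_, ?_⟩
  · refine le_trans (csInf_le ⟨1, ?_⟩ ⟨R, hR.ne_zero, hdeg.symm, hRα, rfl⟩) (HP_le_of_dvd Fq R P hP hRP)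
    rintro x ⟨M, _, _, _, rfl⟩
    exact one_le_HP Fq M
  · refine le_csInf (Set.nonempty_of_mem (x := HP Fq R) ⟨R, hR.ne_zero, hdeg.symm, hRα, rfl⟩) ?_
    rintro x ⟨M, _, _, _, rfl⟩
    exact one_le_HP Fq M

/-- Dirichlet's theorem. -/
lemma dirichlet (n : ℕ) (ξ : K Fq) : ∃ C : ℝ, 1 ≤ C ∧ ∀ h : ℕ, 1 ≤ h → ∃ Q : Polynomial (Polynomial Fq), 
    Q ≠ 0 ∧ Q.natDegree ≤ n ∧ hd Fq Q < h ∧ 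
    absK Fq (evalK Fq Q ξ) ≤ C * ((Fintype.card Fq : ℝ) ^ h) ^ (-(n : ℝ)) := by
  have hq := one_lt_q Fq
  obtain ⟨s, hs⟩ : ∃ s : ℕ, (max 1 (absK Fq ξ)) ^ n ≤ (Fintype.card Fq : ℝ) ^ s := by
    obtain ⟨s, hs⟩ := pow_unbounded_of_one_lt ((max 1 (absK Fq ξ)) ^ n) hq
    exact ⟨s, hs.le⟩
  refine ⟨(Fintype.card Fq : ℝ) ^ s, one_le_pow₀ hq.le, ?_⟩
  intro h hh
  -- the polynomial with given digits
  let mk : (Fin (n+1) × Fin h → Fq) → Polynomial (Polynomial Fq) := fun a =>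
    ∑ x : Fin (n+1) × Fin h, monomial (x.1 : ℕ) (monomial (x.2 : ℕ) (a x))
  have mk_sub : ∀ a b, mk (a - b) = mk a - mk b := by
    intro a b
    simp only [mk, Pi.sub_apply, map_sub, Finset.sum_sub_distrib]
  have mk_coeff : ∀ a x, ((mk a).coeff ((x : Fin (n+1) × Fin h).1 : ℕ)).coeff (x.2 : ℕ) = a x := by
    intro a x
    simp only [mk, finsetSum_coeff]
    rw [Finset.sum_eq_single x]
    · simp
    · intro b _ hb
      rw [coeff_monomial]
      split_ifs with h1
      · rw [coeff_monomial, if_neg]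
        intro h2
        exact hb (Prod.ext (Fin.ext h1) (Fin.ext h2))
      · simp
    · simp
  have mk_deg : ∀ a, (mk a).natDegree ≤ n := by
    intro a
    apply natDegree_sum_le_of_forall_le
    intro x _
    exact (natDegree_monomial_le _).trans (by have := x.1.2; omega)
  have mk_hd : ∀ a, hd Fq (mk a) ≤ h - 1 := by
    intro a
    apply hd_le
    intro i
    simp only [mk, finsetSum_coeff]
    apply natDegree_sum_le_of_forall_le
    intro x _
    rw [coeff_monomial]
    split_ifs
    · exact (natDegree_monomial_le _).trans (by have := x.2.2; omega)
    · simp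
  let W : (Fin (n+1) × Fin h → Fq) → (Fin ((n+1)*h-1) → Fq) := fun a k =>
    (evalK Fq (mk a) ξ).coeff ((k : ℤ) - (h - 1 + s))
  obtain ⟨a, b, hab, hW⟩ : ∃ a b, a ≠ b ∧ W a = W b := by
    apply Fintype.exists_ne_map_eq_of_card_lt
    simp only [Fintype.card_fun, Fintype.card_fin, Fintype.card_prod]
    apply Nat.pow_lt_pow_right
    · exact_mod_cast hq
    · have : 0 < (n+1)*h := by positivity
      omega
  have hev : evalK Fq (mk (a - b)) ξ = evalK Fq (mk a) ξ - evalK Fq (mk b) ξ := by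
    rw [mk_sub, evalK, eval₂_sub]; rfl
  refine ⟨mk (a - b), ?_, mk_deg _, by have := mk_hd (a-b); omega, ?_⟩
  · intro h0
    apply hab
    funext x
    have := mk_coeff (a - b) x
    rw [h0] at this
    simpa [sub_eq_zero, eq_comm] using this
  · -- a priori bound
    have hap : absK Fq (evalK Fq (mk (a-b)) ξ) ≤ (Fintype.card Fq : ℝ) ^ ((h : ℤ) - 1 + s) := by
      have h1 := taylor_bound (avC Fq) (avC_nonarch Fq) ((mk (a-b)).map (embbar Fq)) n 
        (natDegree_map_le.trans (mk_deg _)) (HP Fq (mk (a-b))) 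
        (fun k => by rw [coeff_map]; exact avC_coeff_le Fq _ k) (algebraMap _ _ ξ) 0
      rw [taylor_coeff_zero, eval_map, avC_algebraMap] at h1
      rw [absK_evalK, evalKbar]
      refine h1.trans ?_
      rw [zpow_add₀ (by positivity), zpow_natCast]
      apply mul_le_mul _ hs (by positivity) (by positivity)
      rw [HP_eq, ← zpow_natCast]
      apply zpow_le_zpow_right₀ hq.le
      have := mk_hd (a-b); omega
    have hlow : ∀ m : ℤ, m < -((h : ℤ) - 1 + s) → (evalK Fq (mk (a-b)) ξ).coeff m = 0 := by
      intro m hm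
      by_cases hz : evalK Fq (mk (a-b)) ξ = 0
      · rw [hz]; simp
      · apply HahnSeries.coeff_eq_zero_of_lt_order
        rw [absK, if_neg hz] at hap
        have := (zpow_le_zpow_iff_right₀ hq).1 hap
        omega
    have := absK_le_of_coeff Fq (evalK Fq (mk (a-b)) ξ) ((n:ℤ) * h - s) (by
      intro m hm
      by_cases hm1 : m < -((h : ℤ) - 1 + s)
      · exact hlow m hm1
      · have hlt : (m + (h - 1 + s)).toNat < (n+1)*h-1 := by
          zify [show 1 ≤ (n+1)*h by have : 0 < (n+1)*h := by positivity
                                    omega]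
          rw [Int.toNat_of_nonneg (by omega)]
          linarith
        have := congrFun hW ⟨(m + (h - 1 + s)).toNat, hlt⟩
        simp only [W] at this
        rw [Int.toNat_of_nonneg (by omega), add_sub_cancel_right] at this
        rw [hev, HahnSeries.coeff_sub, this, sub_self])
    refine this.trans (le_of_eq ?_)
    rw [← Real.rpow_natCast, ← Real.rpow_natCast, ← Real.rpow_intCast, ← Real.rpow_mul (by positivity), 
      ← Real.rpow_add (by positivity)]
    congr 1
    push_cast; ring

lemma evalK_mul (P Q : Polynomial (Polynomial Fq)) (ξ : K Fq) :
    absK Fq (evalK Fq (P * Q) ξ) = absK Fq (evalK Fq P ξ) * absK Fq (evalK Fq Q ξ) := by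
  rw [absK_evalK, absK_evalK, absK_evalK, ← map_mul, evalKbar, eval₂_mul]; rfl

lemma absK_pos (x : K Fq) (hx : x ≠ 0) : 0 < absK Fq x := by
  rw [← avC_algebraMap]
  apply (avC Fq).pos
  simpa using hx

lemma one_le_const (P : Polynomial (Polynomial Fq)) (hP : P ≠ 0) (hd : P.natDegree = 0) (ξ : K Fq) :
    1 ≤ absK Fq (evalK Fq P ξ) := by
  obtain ⟨c, rfl⟩ := natDegree_eq_zero.1 hd
  rw [absK_evalK, evalKbar, eval₂_C]
  exact one_le_avC_embbar Fq c (by simpa using hP)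

lemma small (E a : ℝ) (ha : 0 < a) : ∃ N : ℕ, ∀ h : ℕ, N ≤ h → E * ((Fintype.card Fq : ℝ) ^ h) ^ (-a) < 1 := by
  have h1 : Filter.Tendsto (fun h : ℕ => E * ((Fintype.card Fq : ℝ) ^ h) ^ (-a)) Filter.atTop (nhds (E * 0)) := by
    apply Filter.Tendsto.const_mul
    exact (tendsto_rpow_neg_atTop ha).comp (tendsto_pow_atTop_atTop_of_one_lt (one_lt_q Fq))
  rw [mul_zero] at h1
  exact Filter.eventually_atTop.1 (h1.eventually_lt_const one_pos)

lemma irr_red (n : ℕ) (ξ : K Fq) (hnotalg : ¬ IsAlgDegLe Fq ξ n) (w w₂ : ℝ) (hw : 0 ≤ w) (hlt : w < w₂)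
    (hmem : w₂ ∈ wnSet Fq ξ n) (N : ℕ) : ∃ R : Polynomial (Polynomial Fq), Irreducible R ∧ 1 ≤ R.natDegree ∧ 
      R.natDegree ≤ n ∧ N ≤ hd Fq R ∧ absK Fq (evalK Fq R ξ) < HP Fq R ^ (-w) := by
  by_contra hcon
  push Not at hcon
  have hq := one_lt_q Fq
  have hpos : ∀ P : Polynomial (Polynomial Fq), P ≠ 0 → P.natDegree ≤ n → 0 < absK Fq (evalK Fq P ξ) := by
    intro P hP hd
    apply absK_pos
    intro h0
    exact hnotalg ⟨P, hP, hd, h0⟩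
  have hHP0 : ∀ P, 0 < HP Fq P := fun P => zero_lt_one.trans_le (one_le_HP Fq P)
  have hHPw : ∀ P, HP Fq P ^ (-w) ≤ 1 := fun P => 
    Real.rpow_le_one_of_one_le_of_nonpos (one_le_HP Fq P) (by linarith)
  obtain ⟨δ, hδ0, hδ1, hδ⟩ : ∃ δ : ℝ, 0 < δ ∧ δ ≤ 1 ∧ ∀ P : Polynomial (Polynomial Fq), P ≠ 0 → P.natDegree ≤ n → 
      hd Fq P ≤ N → δ ≤ absK Fq (evalK Fq P ξ) := by
    set S := (finite_bdd Fq n N).toFinset.erase 0 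
    by_cases hS : S.Nonempty
    · obtain ⟨P₀, hP₀, hmin⟩ := S.exists_min_image (fun P => absK Fq (evalK Fq P ξ)) hS
      have hP₀' : P₀ ≠ 0 ∧ P₀.natDegree ≤ n ∧ hd Fq P₀ ≤ N := by simpa [S] using hP₀
      refine ⟨min 1 (absK Fq (evalK Fq P₀ ξ)), lt_min one_pos (hpos _ hP₀'.1 hP₀'.2.1), min_le_left _ _, ?_⟩
      intro P h1 h2 h3
      exact (min_le_right _ _).trans (hmin P (by simp [S, h1, h2, h3]))
    · refine ⟨1, one_pos, le_rfl, ?_⟩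
      intro P h1 h2 h3
      exact absurd ⟨P, by simp [S, h1, h2, h3]⟩ hS
  have hirr : ∀ R : Polynomial (Polynomial Fq), Irreducible R → R.natDegree ≤ n → 
      δ ^ R.natDegree * HP Fq R ^ (-w) ≤ absK Fq (evalK Fq R ξ) := by
    intro R hR hdn
    have hR0 : 0 ≤ HP Fq R ^ (-w) := (Real.rpow_pos_of_pos (hHP0 R) _).le
    rcases Nat.eq_zero_or_pos R.natDegree with h0 | h1
    · rw [h0, pow_zero, one_mul]
      exact (hHPw R).trans (one_le_const Fq R hR.ne_zero h0 ξ)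
    · have hd1 : δ ^ R.natDegree ≤ δ := pow_le_of_le_one hδ0.le hδ1 (by omega)
      rcases Nat.lt_or_ge (hd Fq R) N with h2 | h2
      · calc _ ≤ δ * 1 := mul_le_mul hd1 (hHPw R) hR0 hδ0.le
          _ ≤ _ := by rw [mul_one]; exact hδ R hR.ne_zero hdn h2.le
      · refine le_trans ?_ (hcon R hR h1 hdn h2)
        exact mul_le_of_le_one_left hR0 (hd1.trans hδ1)
  have hall : ∀ P : Polynomial (Polynomial Fq), P ≠ 0 → P.natDegree ≤ n → 
      δ ^ P.natDegree * HP Fq P ^ (-w) ≤ absK Fq (evalK Fq P ξ) := by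
    intro P
    induction P using UniqueFactorizationMonoid.induction_on_prime with
    | h₁ => intro h; exact absurd rfl h
    | h₂ x hx =>
      intro h _
      have h0 : x.natDegree = 0 := natDegree_eq_zero_of_isUnit hx
      rw [h0, pow_zero, one_mul]
      exact (hHPw x).trans (one_le_const Fq x h h0 ξ)
    | h₃ a p ha hp ih =>
      intro _ hn
      rw [natDegree_mul hp.ne_zero ha] at hn ⊢
      have h1 := hirr p hp.irreducible (by omega)
      have h2 := ih ha (by omega)
      rw [HP_mul Fq _ _ hp.ne_zero ha, evalK_mul, Real.mul_rpow (hHP0 _).le (hHP0 _).le, pow_add]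
      have h3 : 0 ≤ HP Fq a ^ (-w) := (Real.rpow_pos_of_pos (hHP0 a) _).le
      calc _ = (δ ^ p.natDegree * HP Fq p ^ (-w)) * (δ ^ a.natDegree * HP Fq a ^ (-w)) := by ring
        _ ≤ _ := mul_le_mul h1 h2 (by positivity) ((hpos p hp.ne_zero (by omega)).le)
  obtain ⟨M, hM⟩ := small Fq ((δ ^ n)⁻¹) (w₂ - w) (by linarith)
  apply hmem
  apply (finite_bdd Fq n M).subset
  rintro P ⟨hPn, hP0, hPlt⟩
  refine ⟨hPn, ?_⟩
  by_contra hgt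
  have hPne : P ≠ 0 := by
    rintro rfl
    simp [evalK, absK] at hP0
  have h1 := (hall P hPne hPn).trans_lt hPlt
  have h2 := hM (hd Fq P) (by omega)
  rw [← HP_eq, inv_mul_lt_iff₀ (by positivity), mul_one] at h2
  have h3 : δ ^ n ≤ δ ^ P.natDegree := pow_le_pow_of_le_one hδ0.le hδ1 hPn
  have h4 : 0 < HP Fq P ^ (-w) := Real.rpow_pos_of_pos (hHP0 P) _
  have h5 : HP Fq P ^ (-w₂) = HP Fq P ^ (-(w₂ - w)) * HP Fq P ^ (-w) := by
    rw [← Real.rpow_add (hHP0 P)]; congr 1; ring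
  rw [h5] at h1
  have := lt_of_mul_lt_mul_right h1 h4.le
  linarith

lemma mem_wnSet (n : ℕ) (hn : 1 ≤ n) (ξ : K Fq) (hnotalg : ¬ IsAlgDegLe Fq ξ n) (w : ℝ) (hw : 0 ≤ w) (hlt : w < n) :
    w ∈ wnSet Fq ξ n := by
  intro hfin
  have hq := one_lt_q Fq
  obtain ⟨C, hC1, hC⟩ := dirichlet Fq n ξ
  obtain ⟨δ, hδ0, hδ⟩ : ∃ δ : ℝ, 0 < δ ∧ ∀ P ∈ hfin.toFinset, δ ≤ absK Fq (evalK Fq P ξ) := by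
    by_cases hS : hfin.toFinset.Nonempty
    · obtain ⟨P₀, hP₀, hmin⟩ := hfin.toFinset.exists_min_image (fun P => absK Fq (evalK Fq P ξ)) hS
      rw [Set.Finite.mem_toFinset] at hP₀
      exact ⟨_, hP₀.2.1, hmin⟩
    · exact ⟨1, one_pos, fun P hP => absurd ⟨P, hP⟩ hS⟩
  obtain ⟨N₁, hN₁⟩ := small Fq C (n - w) (by linarith)
  obtain ⟨N₂, hN₂⟩ := small Fq (C / δ) n (by exact_mod_cast hn)
  set h := N₁ + N₂ + 1
  obtain ⟨Q, hQ0, hQn, hQh, hQ⟩ := hC h (by omega)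
  have h1 := hN₁ h (by omega)
  have h2 := hN₂ h (by omega)
  have hH0 : 0 < (Fintype.card Fq : ℝ) ^ h := by positivity
  have hQpos : 0 < absK Fq (evalK Fq Q ξ) := absK_pos Fq _ fun h0 => hnotalg ⟨Q, hQ0, hQn, h0⟩
  have hmem : Q ∈ hfin.toFinset := by
    rw [Set.Finite.mem_toFinset]
    refine ⟨hQn, hQpos, ?_⟩
    calc _ ≤ C * ((Fintype.card Fq : ℝ) ^ h) ^ (-(n : ℝ)) := hQ
      _ = (C * ((Fintype.card Fq : ℝ) ^ h) ^ (-(n - w : ℝ))) * ((Fintype.card Fq : ℝ) ^ h) ^ (-w) := by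
        rw [mul_assoc, ← Real.rpow_add hH0]; congr 2; ring
      _ < 1 * ((Fintype.card Fq : ℝ) ^ h) ^ (-w) := by
        apply mul_lt_mul_of_pos_right h1 (Real.rpow_pos_of_pos hH0 _)
      _ = ((Fintype.card Fq : ℝ) ^ h) ^ (-w) := one_mul _
      _ ≤ _ := by
        rw [HP_eq]
        apply Real.rpow_le_rpow_of_nonpos (by positivity) _ (by linarith)
        exact pow_le_pow_right₀ hq.le hQh.le
  have h3 := (hδ Q hmem).trans hQ
  rw [div_mul_eq_mul_div, div_lt_one hδ0] at h2
  linarith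

/-- Taylor coefficients are controlled by the value when no root is close. -/
lemma far_roots (P : Polynomial (Polynomial Fq)) (hP : P ≠ 0) (r : Kbar Fq) (ρ : ℝ) (hρ : 0 < ρ)
    (hfar : ∀ γ, evalKbar Fq P γ = 0 → ρ ≤ absC Fq (r - γ)) (k : ℕ) :
    avC Fq ((taylor r (P.map (embbar Fq))).coeff k) * ρ ^ k ≤ avC Fq (evalKbar Fq P r) := by
  have h := splits_coeff_bound (avC Fq) (avC_nonarch Fq) ρ hρ (taylor r (P.map (embbar Fq))) 
    (IsAlgClosed.splits _) (by
      intro a ha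
      have h1 := isRoot_of_mem_roots ha
      rw [IsRoot.def, taylor_eval, eval_map] at h1
      have h2 := hfar _ h1
      rw [← avC_apply] at h2
      have h3 : r - (a + r) = -a := by ring
      rwa [h3, AbsoluteValue.map_neg] at h2) k
  rwa [taylor_coeff_zero, eval_map] at h

lemma key (n : ℕ) (ξ : K Fq) (u w w' : ℝ) (hu0 : 0 < u) (huw : u ≤ w) (hun : u ≤ n)
    (h1 : 0 < 2 * u - 2 * n + 2) (h2 : 0 < w + 2 * u - 2 * n + 1 - 2 * w') (h3 : 0 < w + u - w' - 1) :
    ∃ N : ℕ, ∀ P : Polynomial (Polynomial Fq), Irreducible P → 1 ≤ P.natDegree → P.natDegree ≤ n →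
      N ≤ hd Fq P → absK Fq (evalK Fq P ξ) < HP Fq P ^ (-w) → 
      ∃ γ : Kbar Fq, IsAlgKbar Fq γ ∧ degAbar Fq γ ≤ n ∧ HAbar Fq γ ≤ HP Fq P ∧ 1 ≤ HAbar Fq γ ∧
        absC Fq (algebraMap (K Fq) (Kbar Fq) ξ - γ) < HP Fq P ^ (-w' - 1) ∧ 
        ∃ M : Polynomial (Polynomial Fq), M ≠ 0 ∧ M.natDegree ≤ n ∧ evalKbar Fq M γ = 0 := by
  have hq := one_lt_q Fq
  obtain ⟨C, hC1, hC⟩ := dirichlet Fq n ξ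
  set r : Kbar Fq := algebraMap (K Fq) (Kbar Fq) ξ with hr
  set B : ℝ := (max 1 (avC Fq r)) ^ n with hB
  have hB1 : 1 ≤ B := one_le_pow₀ (le_max_left _ _)
  set E : ℝ := C ^ 2 * B ^ (2 * n) with hE
  have hBn : 1 ≤ B ^ (2 * n) := one_le_pow₀ hB1
  have hC2 : C ≤ C ^ 2 := by nlinarith
  have hC2E : C ^ 2 ≤ E := le_mul_of_one_le_right (by positivity) hBn
  have hCE : C ≤ E := hC2.trans hC2E
  obtain ⟨N₁, hN₁⟩ := small Fq E _ h1
  obtain ⟨N₂, hN₂⟩ := small Fq E _ h2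
  obtain ⟨N₃, hN₃⟩ := small Fq E _ h3
  obtain ⟨N₄, hN₄⟩ := small Fq E u hu0
  obtain ⟨N₅, hN₅⟩ := small Fq E (2 * u) (by linarith)
  refine ⟨N₁ + N₂ + N₃ + N₄ + N₅ + 1, ?_⟩
  intro P hPirr hPd hPn hPN hPlt
  obtain ⟨Q, hQ0, hQn, hQh, hQ⟩ := hC (hd Fq P) (by omega)
  have e1 := hN₁ (hd Fq P) (by omega)
  have e2 := hN₂ (hd Fq P) (by omega)
  have e3 := hN₃ (hd Fq P) (by omega)
  have e4 := hN₄ (hd Fq P) (by omega)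
  have e5 := hN₅ (hd Fq P) (by omega)
  rw [← HP_eq] at e1 e2 e3 e4 e5 hQ
  have hH1 := one_le_HP Fq P
  have hQP : HP Fq Q ≤ HP Fq P := pow_le_pow_right₀ hq.le hQh.le
  have hQPlt : HP Fq Q < HP Fq P := pow_lt_pow_right₀ hq hQh
  set H := HP Fq P with hH
  have hH0 : 0 < H := by linarith
  have hE0 : 0 ≤ E := by linarith
  have hndvd : ¬ P ∣ Q := fun h => not_lt.2 (HP_le_of_dvd Fq P Q hQ0 h) hQPlt
  have hQe : absK Fq (evalK Fq Q ξ) ≤ C * H ^ (-u) := by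
    refine hQ.trans (mul_le_mul_of_nonneg_left ?_ (by linarith))
    exact Real.rpow_le_rpow_of_exponent_le hH1 (by linarith)
  have hQd : 1 ≤ Q.natDegree := by
    by_contra hlt
    have h4 := one_le_const Fq Q hQ0 (by omega) ξ
    have h5 : C * H ^ (-u) ≤ E * H ^ (-u) := mul_le_mul_of_nonneg_right hCE (by positivity)
    linarith
  set ρ : ℝ := H ^ (-w' - 1) with hρ
  have hρ0 : 0 < ρ := Real.rpow_pos_of_pos hH0 _
  by_cases hroot : ∃ M : Polynomial (Polynomial Fq), ∃ γ, M ≠ 0 ∧ M.natDegree ≤ n ∧ HP Fq M ≤ H ∧ 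
      evalKbar Fq M γ = 0 ∧ absC Fq (r - γ) < ρ
  · obtain ⟨M, γ, hM0, hMn, hMH, hMγ, hγ⟩ := hroot
    obtain ⟨f1, f2, f3, f4⟩ := height_facts Fq M hM0 γ hMγ
    exact ⟨γ, f1, f2.trans hMn, f3.trans hMH, f4, hγ, M, hM0, hMn, hMγ⟩
  exfalso
  push Not at hroot
  have hPfar := far_roots Fq P hPirr.ne_zero r ρ hρ0 (fun γ hγ => hroot P γ hPirr.ne_zero hPn le_rfl hγ)
  have hQfar := far_roots Fq Q hQ0 r ρ hρ0 (fun γ hγ => hroot Q γ hQ0 hQn hQP hγ)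
  rw [← absK_evalK] at hPfar hQfar
  set f := taylor r (P.map (embbar Fq)) with hf
  set g := taylor r (Q.map (embbar Fq)) with hg
  have hfA : ∀ k, avC Fq (f.coeff k) ≤ H * B := fun k => 
    taylor_bound (avC Fq) (avC_nonarch Fq) _ n (natDegree_map_le.trans hPn) H
      (fun k => by rw [coeff_map]; exact avC_coeff_le Fq _ k) r k
  have hgA : ∀ k, avC Fq (g.coeff k) ≤ H * B := fun k => 
    taylor_bound (avC Fq) (avC_nonarch Fq) _ n (natDegree_map_le.trans hQn) H
      (fun k => by rw [coeff_map]; exact (avC_coeff_le Fq _ k).trans hQP) r k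
  obtain ⟨s, t, hst, hM⟩ := sylvester_data (avC Fq) f g P.natDegree Q.natDegree (H * B) (H ^ (-w)) (C * H ^ (-u)) ρ
    hfA hgA (fun k => (hPfar k).trans hPlt.le) (fun k => (hQfar k).trans hQe)
  have hinj := embbar_injective Fq
  have hres : 1 ≤ avC Fq (sylvester f g P.natDegree Q.natDegree).det := by
    have h4 : (sylvester f g P.natDegree Q.natDegree).det = embbar Fq (resultant P Q) := by
      have h5 := resultant_taylor (P.map (embbar Fq)) (Q.map (embbar Fq)) r
      rw [natDegree_taylor, natDegree_taylor, natDegree_map_eq_of_injective hinj,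
        natDegree_map_eq_of_injective hinj, resultant_map_map] at h5
      exact h5
    rw [h4]
    exact one_le_avC_embbar Fq _ (resultant_ne Fq P Q hPirr hPd hndvd)
  have hδ0 : 0 ≤ H ^ (-w) := by positivity
  have hHu : 0 ≤ H ^ (-u) := by positivity
  have hδε : H ^ (-w) ≤ C * H ^ (-u) := 
    (Real.rpow_le_rpow_of_exponent_le hH1 (by linarith : -w ≤ -u)).trans (le_mul_of_one_le_left hHu hC1)
  have hHB1 : 1 ≤ H * B := one_le_mul_of_one_le_of_one_le hH1 hB1
  have hε2 : (C * H ^ (-u)) ^ 2 = C ^ 2 * H ^ (-(2 * u)) := by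
    rw [mul_pow, ← Real.rpow_natCast (H ^ (-u)), ← Real.rpow_mul hH0.le]; congr 2; push_cast; ring
  -- powers of `A`
  have hApow : ∀ (m c : ℕ), m + c ≤ 2 * n → (H * B) ^ m ≤ B ^ (2 * n) * H ^ (2 * n - c : ℝ) := by
    intro m c hmc
    rw [mul_pow, mul_comm]
    apply mul_le_mul (pow_le_pow_right₀ hB1 (by omega)) _ (by positivity) (by positivity)
    rw [← Real.rpow_natCast]
    apply Real.rpow_le_rpow_of_exponent_le hH1
    have : (m : ℝ) + c ≤ 2 * n := by exact_mod_cast hmc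
    linarith
  rcases Nat.lt_or_ge (P.natDegree + Q.natDegree) 3 with hlt | hge
  · have hb := det_bound2 (avC Fq) (avC_nonarch Fq) (by omega) _ s t hst _ _ _ ρ hρ0 hδ0 hδε hM
    have h4 : ρ ≤ avC Fq (sylvester f g P.natDegree Q.natDegree).det * ρ := le_mul_of_one_le_left hρ0.le hres
    have h5 : (C * H ^ (-u)) ^ 2 * ρ < ρ := by
      rw [hε2]
      have : C ^ 2 * H ^ (-(2 * u)) ≤ E * H ^ (-(2 * u)) := mul_le_mul_of_nonneg_right hC2E (by positivity)
      exact mul_lt_of_lt_one_left hρ0 (by linarith)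
    have h6 : H ^ (-w) * (C * H ^ (-u)) < ρ := by
      have e : H ^ (-w) * (C * H ^ (-u)) = C * H ^ (-(w + u - w' - 1)) * ρ := by
        rw [hρ, mul_assoc, ← Real.rpow_add hH0, mul_left_comm, ← Real.rpow_add hH0]; congr 2; ring
      rw [e]
      have : C * H ^ (-(w + u - w' - 1)) ≤ E * H ^ (-(w + u - w' - 1)) := 
        mul_le_mul_of_nonneg_right hCE (by positivity)
      exact mul_lt_of_lt_one_left hρ0 (by linarith)
    have := h4.trans hb
    exact absurd (max_lt h5 h6) (not_lt.2 this)
  · have hb := det_bound3 (avC Fq) (avC_nonarch Fq) hge _ s t hst _ _ _ ρ hρ0 hδ0 hδε (by linarith) hM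
    have hρ2 : 0 < ρ ^ 2 := by positivity
    have h4 : ρ ^ 2 ≤ avC Fq (sylvester f g P.natDegree Q.natDegree).det * ρ ^ 2 := 
      le_mul_of_one_le_left hρ2.le hres
    have hρ2' : ρ ^ 2 = H ^ (-2 * w' - 2) := by
      rw [hρ, ← Real.rpow_natCast, ← Real.rpow_mul hH0.le]; congr 1; push_cast; ring
    have h5 : (C * H ^ (-u)) ^ 2 * (H * B) ^ (P.natDegree + Q.natDegree - 2) * ρ ^ 2 < ρ ^ 2 := by
      apply mul_lt_of_lt_one_left hρ2
      refine lt_of_le_of_lt ?_ e1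
      rw [hε2]
      calc _ ≤ C ^ 2 * H ^ (-(2 * u)) * (B ^ (2 * n) * H ^ (2 * n - (2 : ℕ) : ℝ)) := 
            mul_le_mul_of_nonneg_left (hApow _ 2 (by omega)) (by positivity)
        _ = E * (H ^ (-(2 * u)) * H ^ (2 * n - (2 : ℕ) : ℝ)) := by rw [hE]; ring
        _ = _ := by rw [← Real.rpow_add hH0]; congr 2; push_cast; ring
    have h6 : H ^ (-w) * (C * H ^ (-u)) ^ 2 * (H * B) ^ (P.natDegree + Q.natDegree - 3) < ρ ^ 2 := by
      rw [hε2]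
      calc _ ≤ H ^ (-w) * (C ^ 2 * H ^ (-(2 * u))) * (B ^ (2 * n) * H ^ (2 * n - (3 : ℕ) : ℝ)) := 
            mul_le_mul_of_nonneg_left (hApow _ 3 (by omega)) (by positivity)
        _ = E * (H ^ (-w) * H ^ (-(2 * u)) * H ^ (2 * n - (3 : ℕ) : ℝ)) := by rw [hE]; ring
        _ = E * H ^ (-(w + 2 * u - 2 * n + 1 - 2 * w')) * ρ ^ 2 := by 
          rw [hρ2', mul_assoc E, ← Real.rpow_add hH0, ← Real.rpow_add hH0, ← Real.rpow_add hH0]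
          congr 2; push_cast; ring
        _ < ρ ^ 2 := mul_lt_of_lt_one_left hρ2 e2
    have := h4.trans hb
    exact absurd (max_lt h5 h6) (not_lt.2 this)

lemma mem_wnAtSet (n : ℕ) (ξ : K Fq) (hnotalg : ¬ IsAlgDegLe Fq ξ n) (u w w' w₂ : ℝ) (hu0 : 0 < u) 
    (huw : u ≤ w) (hun : u ≤ n) (h1 : 0 < 2 * u - 2 * n + 2) (h2 : 0 < w + 2 * u - 2 * n + 1 - 2 * w') 
    (h3 : 0 < w + u - w' - 1) (hww₂ : w < w₂) (hw₂ : w₂ ∈ wnSet Fq ξ n) (hw' : 0 ≤ w') : w' ∈ wnAtSet Fq ξ n := by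
  intro hfin
  have hq := one_lt_q Fq
  obtain ⟨N, hN⟩ := key Fq n ξ u w w' hu0 huw hun h1 h2 h3
  obtain ⟨δ, hδ0, hδ⟩ : ∃ δ : ℝ, 0 < δ ∧ ∀ α ∈ hfin.toFinset, δ ≤ absC Fq (algebraMap (K Fq) (Kbar Fq) ξ - α) := by
    by_cases hS : hfin.toFinset.Nonempty
    · obtain ⟨P₀, hP₀, hmin⟩ := hfin.toFinset.exists_min_image 
        (fun α => absC Fq (algebraMap (K Fq) (Kbar Fq) ξ - α)) hS
      rw [Set.Finite.mem_toFinset] at hP₀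
      exact ⟨_, hP₀.2.2.1, hmin⟩
    · exact ⟨1, one_pos, fun P hP => absurd ⟨P, hP⟩ hS⟩
  obtain ⟨N₂, hN₂⟩ := small Fq (1 / δ) (w' + 1) (by linarith)
  obtain ⟨P, hPirr, hPd, hPn, hPN, hPlt⟩ := irr_red Fq n ξ hnotalg w w₂ (by linarith) hww₂ hw₂ (N + N₂)
  obtain ⟨γ, f1, f2, f3, f4, f5, M, hM0, hMn, hMγ⟩ := hN P hPirr hPd hPn (by omega) hPlt
  have hmem : γ ∈ hfin.toFinset := by
    rw [Set.Finite.mem_toFinset]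
    refine ⟨f1, f2, ?_, f5.trans_le ?_⟩
    · rw [← avC_apply]
      apply (avC Fq).pos
      intro h0
      rw [sub_eq_zero] at h0
      rw [← h0, evalKbar_alg, map_eq_zero] at hMγ
      exact hnotalg ⟨M, hM0, hMn, hMγ⟩
    · exact Real.rpow_le_rpow_of_nonpos (by linarith) f3 (by linarith)
  have h4 := hN₂ (hd Fq P) (by omega)
  rw [← HP_eq, div_mul_eq_mul_div, div_lt_one hδ0, one_mul] at h4
  have h5 := hδ γ hmem
  have h6 : -(w' + 1) = -w' - 1 := by ring
  rw [h6] at h4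
  linarith

/-- `w_n^@(ξ) ≥ (w_n(ξ) + 1)/2` for `ξ` not algebraic of degree ≤ n. -/
theorem wnAt_ge_half (Fq : Type) [Field Fq] [Fintype Fq]
    (n : ℕ) (hn : 1 ≤ n) (ξ : K Fq) (hnotalg : ¬ IsAlgDegLe Fq ξ n) :
    (wn Fq ξ n + 1) / 2 ≤ wnAt Fq ξ n := by
  have hn' : (1 : ℝ) ≤ n := by exact_mod_cast hn
  -- a real statement
  have main : ∀ w₀ ∈ wnSet Fq ξ n, ∀ w' : ℝ, 0 ≤ w' → 2 * w' < w₀ + 1 → w' ∈ wnAtSet Fq ξ n := by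
    intro w₀ hw₀ w' hw' hlt
    obtain ⟨η, hη0, hη1, hη2⟩ : ∃ η : ℝ, 0 < η ∧ η < 1 / 2 ∧ 2 * w' < w₀ + 1 - 8 * η := by
      refine ⟨min (1/4) ((w₀ + 1 - 2 * w') / 16), lt_min (by norm_num) (by linarith), 
        (min_le_left _ _).trans_lt (by norm_num), ?_⟩
      have := min_le_right (1/4) ((w₀ + 1 - 2 * w') / 16)
      linarith
    rcases lt_or_ge w₀ n with hc | hc
    · exact mem_wnAtSet Fq n ξ hnotalg (n - η) (n - η) w' (n - η / 2) (by linarith) le_rfl (by linarith) 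
        (by linarith) (by linarith) (by linarith) (by linarith) 
        (mem_wnSet Fq n hn ξ hnotalg _ (by linarith) (by linarith)) hw'
    · exact mem_wnAtSet Fq n ξ hnotalg (n - η) (w₀ - η) w' w₀ (by linarith) (by linarith) (by linarith) 
        (by linarith) (by linarith) (by linarith) (by linarith) hw₀ hw'
  have h0 : (0 : ℝ) ∈ wnSet Fq ξ n := mem_wnSet Fq n hn ξ hnotalg 0 le_rfl (by linarith)
  have hAt : ∀ w' ∈ wnAtSet Fq ξ n, (w' : EReal) ≤ wnAt Fq ξ n := fun w' hw' => le_sSup ⟨w', hw', rfl⟩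
  have hAt0 : ((0 : ℝ) : EReal) ≤ wnAt Fq ξ n := hAt 0 (main 0 h0 0 le_rfl (by norm_num))
  have hwn0 : ((0 : ℝ) : EReal) ≤ wn Fq ξ n := le_sSup ⟨0, h0, rfl⟩
  generalize wnAt Fq ξ n = A at hAt hAt0
  induction A using EReal.rec with
  | bot => simp at hAt0
  | top => exact le_top
  | coe A =>
    have hA0 : 0 ≤ A := by exact_mod_cast hAt0
    have hle : wn Fq ξ n ≤ ((2 * A - 1 : ℝ) : EReal) := by
      apply sSup_le
      rintro _ ⟨w₀, hw₀, rfl⟩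
      apply EReal.coe_le_coe_iff.2
      by_contra hlt
      push Not at hlt
      have h1 := hAt _ (main w₀ hw₀ ((2 * A + w₀ + 1) / 4) (by linarith) (by linarith))
      have h2 : (2 * A + w₀ + 1) / 4 ≤ A := by exact_mod_cast h1
      linarith
    generalize wn Fq ξ n = W at hle hwn0
    induction W using EReal.rec with
    | bot => simp at hwn0
    | top => exact absurd (top_le_iff.1 hle) (EReal.coe_ne_top _)
    | coe W =>
      have h1 : W ≤ 2 * A - 1 := by exact_mod_cast hle
      have h2 : ((W : EReal) + 1) / 2 = (((W + 1) / 2 : ℝ) : EReal) := by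
        rw [EReal.coe_div]; rfl
      rw [h2]
      apply EReal.coe_le_coe_iff.2
      linarith

end
end MahlerKoksmaFq
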